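/- arXiv:1606.06412 — 7 statements merged into one kernel-verified Lean document; each statement's English description precedes it below -/
import Mathlib

section
/- For all integers k ≥ 2 and t ≥ k, there exists a k-connected finite simple graph G with tw(G) = k and gon(G) ≥ t. -/
open SimpleGraph Finset
open scoped Classical

noncomputable section

def lap {V : Type} [Fintype V] (G : SimpleGraph V) (S : V → ℤ) : V → ℤ :=
  fun v => ∑ w : V, if G.Adj v w then S v - S w else 0

def Effective {V : Type} (D : V → ℤ) : Prop := ∀ v, 0 ≤ D v

def degDiv {V : Type} [Fintype V] (D : V → ℤ) : ℤ := ∑ v, D v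

def LinEquiv {V : Type} [Fintype V] (G : SimpleGraph V) (D D' : V → ℤ) : Prop :=
  ∃ S : V → ℤ, D' = D - lap G S

def PosRank {V : Type} [Fintype V] (G : SimpleGraph V) (D : V → ℤ) : Prop :=
  ∀ v : V, ∃ D' : V → ℤ, Effective D' ∧ LinEquiv G D D' ∧ 1 ≤ D' v

def gonality {V : Type} [Fintype V] (G : SimpleGraph V) : ℕ :=
  sInf {n : ℕ | ∃ D : V → ℤ, Effective D ∧ PosRank G D ∧ degDiv D = (n : ℤ)}

def indic {V : Type} (A : Set V) : V → ℤ := fun v => if v ∈ A then 1 else 0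

/-- A tree decomposition of `G`, with tree `T` and bags `bag`. -/
def IsTreeDecomp {V : Type} {m : ℕ} (G : SimpleGraph V) (T : SimpleGraph (Fin m))
    (bag : Fin m → Finset V) : Prop :=
  T.IsTree ∧ (∀ v, ∃ t, v ∈ bag t) ∧ (∀ u v, G.Adj u v → ∃ t, u ∈ bag t ∧ v ∈ bag t) ∧
  (∀ v : V, (T.induce {t | v ∈ bag t}).Connected)

/-- The treewidth of `G`: the least `k` so that some tree decomposition has all
bags of size at most `k + 1`. -/
def treewidth {V : Type} [Fintype V] (G : SimpleGraph V) : ℕ :=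
  sInf {k : ℕ | ∃ (m : ℕ) (T : SimpleGraph (Fin m)) (bag : Fin m → Finset V),
    IsTreeDecomp G T bag ∧ ∀ t, (bag t).card ≤ k + 1}

/-- `G` is `k`-connected: more than `k` vertices, and removing fewer than `k`
vertices leaves a connected graph. -/
def KConnected {V : Type} [Fintype V] (G : SimpleGraph V) (k : ℕ) : Prop :=
  k < Fintype.card V ∧ ∀ S : Finset V, S.card < k → (G.induce ((↑S : Set V)ᶜ)).Connected

section TreeDecomposition

variable {m : ℕ} {T : SimpleGraph (Fin m)}

/-- In a tree, a path from `r` to a vertex of a connected set `B` enters `B` at the vertex of `B`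
closest to `r` and stays in `B` from then on. -/
lemma exists_path_through_closest (hT : T.IsTree) {B : Set (Fin m)} (hB : (T.induce B).Connected)
    {r b s : Fin m} (hb : b ∈ B) (hmin : ∀ z ∈ B, T.dist r b ≤ T.dist r z) (hs : s ∈ B) :
    ∃ p : T.Walk r s, p.IsPath ∧ p.getVert (T.dist r b) = b ∧
      ∀ i, T.dist r b ≤ i → p.getVert i ∈ B := by
  obtain ⟨P, hP, hPl⟩ := hT.connected.exists_path_of_dist r b
  obtain ⟨Q', hQ'⟩ := (hB.preconnected ⟨b, hb⟩ ⟨s, hs⟩).exists_isPath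
  let Q : T.Walk b s := Q'.map (Embedding.induce B).toHom
  have hQ : Q.IsPath := hQ'.map (Embedding.induce (G := T) B).injective
  have hQB : ∀ z ∈ Q.support, z ∈ B := by
    intro z hz
    have hz' : z ∈ (Q'.map (Embedding.induce B).toHom).support := hz
    rw [Walk.support_map, List.mem_map] at hz'
    obtain ⟨y, -, rfl⟩ := hz'
    exact y.2
  refine ⟨P.append Q, ?_, ?_, ?_⟩
  · rw [Walk.isPath_def, Walk.support_append]
    refine List.Nodup.append hP.support_nodup (hQ.support_nodup.sublist (List.tail_sublist _)) ?_
    intro z hzP hzQ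
    have hzB := hmin z (hQB z (List.mem_of_mem_tail hzQ))
    have h1 := dist_le (P.takeUntil z hzP)
    have h2 := congrArg Walk.length (P.take_spec hzP)
    rw [Walk.length_append] at h2
    have hzb : z = b := Walk.eq_of_length_eq_zero (p := P.dropUntil z hzP) (by omega)
    have hnd := hQ.support_nodup
    rw [← Walk.cons_tail_support Q, List.nodup_cons] at hnd
    exact hnd.1 (hzb ▸ hzQ)
  · rw [Walk.getVert_append, ← hPl]
    simp
  · intro i hi
    rw [Walk.getVert_append, if_neg (by omega)]
    exact hQB _ (Walk.getVert_mem_support _ _)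

/-- Some bag of a tree decomposition contains a vertex together with all its neighbours. -/
lemma exists_closed_neighborhood_subset_bag {V : Type} [Fintype V] [Nonempty V]
    {G : SimpleGraph V} {bag : Fin m → Finset V} (h : IsTreeDecomp G T bag) :
    ∃ v x, v ∈ bag x ∧ ∀ u, G.Adj v u → u ∈ bag x := by
  obtain ⟨hT, hcov, hedge, hconn⟩ := h
  obtain ⟨r⟩ := hT.connected.nonempty
  have htop : ∀ v, ∃ x, v ∈ bag x ∧ ∀ z, v ∈ bag z → T.dist r x ≤ T.dist r z := by
    intro v
    obtain ⟨x₀, hx₀⟩ := hcov v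
    obtain ⟨x, hx, hmin⟩ := Finset.exists_min_image (univ.filter fun x => v ∈ bag x) (T.dist r)
      ⟨x₀, by simpa using hx₀⟩
    exact ⟨x, by simpa using hx, fun z hz => hmin z (by simpa using hz)⟩
  choose top htop hmin using htop
  obtain ⟨v, -, hv⟩ := Finset.exists_max_image univ (fun v => T.dist r (top v)) univ_nonempty
  refine ⟨v, top v, htop v, fun u huv => ?_⟩
  obtain ⟨s, hvs, hus⟩ := hedge v u huv
  obtain ⟨p, hp, hpv, -⟩ := exists_path_through_closest hT (hconn v) (htop v) (hmin v) hvs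
  obtain ⟨q, hq, -, hqu⟩ := exists_path_through_closest hT (hconn u) (htop u) (hmin u) hus
  have hpq : p = q := (hT.existsUnique_path r s).unique hp hq
  have := hqu _ (hv u (mem_univ u))
  rwa [← hpq, hpv] at this

lemma KConnected.le_card_neighbors {V : Type} [Fintype V] {G : SimpleGraph V} {k : ℕ}
    (h : KConnected G k) (v : V) : k ≤ (univ.filter fun u => G.Adj v u).card := by
  by_contra! hlt
  have hconn := h.2 _ hlt
  set N := univ.filter fun u => G.Adj v u with hN
  obtain ⟨w, hw⟩ : ∃ w, w ∉ insert v N := by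
    by_contra! hall
    have h1 := Finset.card_le_card (fun w _ => hall w : univ ⊆ insert v N)
    have h2 := Finset.card_insert_le v N
    have h3 := h.1
    rw [Finset.card_univ] at h1
    omega
  rw [Finset.mem_insert, not_or] at hw
  have hv : v ∉ N := by simp [hN]
  have : Nontrivial ↥((↑N : Set V)ᶜ) :=
    ⟨⟨v, by simpa using hv⟩, ⟨w, by simpa using hw.2⟩, fun e => hw.1 (congrArg Subtype.val e).symm⟩
  obtain ⟨⟨u, hu⟩, hadj⟩ := hconn.preconnected.exists_adj_of_nontrivial ⟨v, by simpa using hv⟩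
  simp only [comap_adj, Function.Embedding.subtype_apply] at hadj
  exact hu (by simpa [hN] using hadj)

/-- Every bag bound for a tree decomposition of a `k`-connected graph is at least `k + 1`. -/
lemma KConnected.le_width {V : Type} [Fintype V] {G : SimpleGraph V} {k l : ℕ}
    (h : KConnected G k) {bag : Fin m → Finset V} (hdec : IsTreeDecomp G T bag)
    (hl : ∀ s, (bag s).card ≤ l + 1) : k ≤ l := by
  have : Nonempty V := Fintype.card_pos_iff.mp (by have := h.1; omega)
  obtain ⟨v, x, hv, hx⟩ := exists_closed_neighborhood_subset_bag hdec
  have h1 : insert v (univ.filter fun u => G.Adj v u) ⊆ bag x := by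
    intro u hu
    rcases Finset.mem_insert.mp hu with rfl | hu
    · exact hv
    · exact hx u (by simpa using hu)
  have h2 := Finset.card_le_card h1
  rw [Finset.card_insert_of_notMem (by simp)] at h2
  have := h.le_card_neighbors v
  have := hl x
  omega

end TreeDecomposition

section Intervals

lemma pathGraph_isTree (n : ℕ) : (pathGraph (n + 1)).IsTree := by
  rw [isTree_iff_connected_and_card]
  refine ⟨pathGraph_connected n,
    le_antisymm ?_ (pathGraph_connected n).card_vert_le_card_edgeSet_add_one⟩
  let f : Fin n → (pathGraph (n + 1)).edgeSet := fun i =>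
    ⟨s(i.castSucc, i.succ), by simp [pathGraph_adj]⟩
  have hf : Function.Surjective f := by
    rintro ⟨e, he⟩
    induction e using Sym2.ind with
    | _ a b =>
      rw [mem_edgeSet, pathGraph_adj] at he
      rcases he with h | h
      · refine ⟨⟨a.val, by omega⟩, Subtype.ext ?_⟩
        simp only [f, Sym2.eq_iff, Fin.ext_iff, Fin.val_castSucc, Fin.val_succ]
        lia
      · refine ⟨⟨b.val, by omega⟩, Subtype.ext ?_⟩
        simp only [f, Sym2.eq_iff, Fin.ext_iff, Fin.val_castSucc, Fin.val_succ]
        lia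
  have := Nat.card_le_card_of_surjective f hf
  simp only [Nat.card_eq_fintype_card, Fintype.card_fin] at this ⊢
  omega

/-- If consecutive vertices are adjacent, then intervals induce connected subgraphs. -/
lemma induce_connected_of_ordConnected {n : ℕ} {G : SimpleGraph (Fin n)} {s : Set (Fin n)}
    (hadj : ∀ i ∈ s, ∀ j ∈ s, i.val + 1 = j.val → G.Adj i j) (hne : s.Nonempty)
    (hs : s.OrdConnected) : (G.induce s).Connected := by
  have key : ∀ (d : ℕ) (i j : Fin n) (hi : i ∈ s) (hj : j ∈ s), i.val + d = j.val →
      (G.induce s).Reachable ⟨i, hi⟩ ⟨j, hj⟩ := by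
    intro d
    induction d with
    | zero =>
      intro i j hi hj hij
      obtain rfl : i = j := Fin.ext (by omega)
      exact Reachable.refl _
    | succ d ih =>
      intro i j hi hj hij
      have hl : i.val + d < n := by have := j.2; omega
      have hmem : (⟨i.val + d, hl⟩ : Fin n) ∈ s :=
        hs.out hi hj ⟨Fin.le_def.mpr (by simp), Fin.le_def.mpr (by simp only; omega)⟩
      refine (ih i ⟨i.val + d, hl⟩ hi hmem rfl).trans (Adj.reachable ?_)
      exact hadj _ hmem j hj (by simp only; omega)
  have := hne.to_subtype
  refine ⟨fun ⟨i, hi⟩ ⟨j, hj⟩ => ?_⟩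
  rcases le_total i.val j.val with h | h
  · exact key (j.val - i.val) i j hi hj (by omega)
  · exact (key (i.val - j.val) j i hj hi (by omega)).symm

end Intervals

section Divisors

variable {V : Type} [Fintype V] {G : SimpleGraph V} {S D D' : V → ℤ} {d : ℕ}

lemma sum_sum_internal_eq_zero {V : Type} (G : SimpleGraph V) (S : V → ℤ) (A : Finset V) :
    ∑ v ∈ A, ∑ w ∈ A, (if G.Adj v w then S v - S w else 0) = 0 := by
  have h : ∑ v ∈ A, ∑ w ∈ A, (if G.Adj v w then S v - S w else 0) =
      -∑ v ∈ A, ∑ w ∈ A, (if G.Adj v w then S v - S w else 0) := by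
    conv_lhs => rw [Finset.sum_comm]
    rw [← Finset.sum_neg_distrib]
    refine Finset.sum_congr rfl fun v _ => ?_
    rw [← Finset.sum_neg_distrib]
    refine Finset.sum_congr rfl fun w _ => ?_
    rw [G.adj_comm]
    split_ifs <;> ring
  omega

lemma sum_lap (G : SimpleGraph V) (S : V → ℤ) : ∑ v, lap G S v = 0 :=
  sum_sum_internal_eq_zero G S univ

lemma lap_neg (G : SimpleGraph V) (S : V → ℤ) : lap G (-S) = -lap G S := by
  funext v
  simp only [lap, Pi.neg_apply]
  rw [← Finset.sum_neg_distrib]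
  refine Finset.sum_congr rfl fun w _ => ?_
  split_ifs <;> ring

/-- Moving between effective divisors of degree `d`, at most `d` neighbours of a vertex fire
less often than that vertex. -/
lemma card_adj_lt_le (hD : Effective D) (hD' : Effective D') (hdeg : degDiv D = d)
    (hS : D' = D - lap G S) (u : V) :
    (univ.filter fun w => G.Adj u w ∧ S w < S u).card ≤ d := by
  set A := univ.filter fun v => S u ≤ S v with hA
  have hle : ∑ v ∈ A, lap G S v ≤ d := by
    rw [← hdeg, degDiv]
    refine (Finset.sum_le_sum fun v _ => ?_).trans
      (Finset.sum_le_sum_of_subset_of_nonneg (subset_univ A) fun v _ _ => hD v)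
    have h1 := hD' v
    rw [hS, Pi.sub_apply] at h1
    omega
  have hsplit : ∑ v ∈ A, lap G S v =
      ∑ v ∈ A, ∑ w ∈ Aᶜ, (if G.Adj v w then S v - S w else 0) := by
    have h1 : ∑ v ∈ A, lap G S v = ∑ v ∈ A, (∑ w ∈ A, (if G.Adj v w then S v - S w else 0) +
        ∑ w ∈ Aᶜ, (if G.Adj v w then S v - S w else 0)) :=
      Finset.sum_congr rfl fun v _ => (Finset.sum_add_sum_compl A _).symm
    rw [h1, Finset.sum_add_distrib, sum_sum_internal_eq_zero, zero_add]
  have hterm : ∀ v ∈ A, ∀ w ∈ Aᶜ, 0 ≤ (if G.Adj v w then S v - S w else 0) := by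
    intro v hv w hw
    simp only [hA, mem_filter, mem_compl, mem_univ, true_and] at hv hw
    split_ifs <;> omega
  have huA : u ∈ A := by simp [hA]
  have hcard : ((univ.filter fun w => G.Adj u w ∧ S w < S u).card : ℤ) ≤
      ∑ w ∈ Aᶜ, (if G.Adj u w then S u - S w else 0) := by
    rw [Finset.card_eq_sum_ones, Nat.cast_sum]
    refine (Finset.sum_le_sum fun w hw => ?_).trans
      (Finset.sum_le_sum_of_subset_of_nonneg ?_ fun w hw _ => hterm u huA w hw)
    · simp only [mem_filter, mem_univ, true_and] at hw
      rw [if_pos hw.1]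
      push_cast
      omega
    · intro w hw
      simp only [hA, mem_filter, mem_compl, mem_univ, true_and] at hw ⊢
      omega
  have hone := Finset.single_le_sum (f := fun v => ∑ w ∈ Aᶜ, (if G.Adj v w then S v - S w else 0))
    (fun v hv => Finset.sum_nonneg (hterm v hv)) huA
  omega

lemma card_adj_ne_le (hD : Effective D) (hD' : Effective D') (hdeg : degDiv D = d)
    (hS : D' = D - lap G S) (u : V) :
    (univ.filter fun w => G.Adj u w ∧ S w ≠ S u).card ≤ 2 * d := by
  have hdeg' : degDiv D' = d := by
    rw [← hdeg, hS, degDiv, degDiv]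
    simp only [Pi.sub_apply, Finset.sum_sub_distrib, sum_lap, sub_zero]
  have h1 := card_adj_lt_le hD hD' hdeg hS u
  have h2 := card_adj_lt_le (S := -S) hD' hD hdeg' (by rw [lap_neg, hS]; ring) u
  have h3 : (univ.filter fun w => G.Adj u w ∧ S w ≠ S u) ⊆
      (univ.filter fun w => G.Adj u w ∧ S w < S u) ∪
        (univ.filter fun w => G.Adj u w ∧ (-S) w < (-S) u) := by
    intro w hw
    simp only [mem_filter, mem_univ, true_and, mem_union, Pi.neg_apply, neg_lt_neg_iff] at hw ⊢
    rcases lt_or_gt_of_ne hw.2 with h | h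
    · exact Or.inl ⟨hw.1, h⟩
    · exact Or.inr ⟨hw.1, h⟩
  have h4 := Finset.card_le_card h3
  have h5 := Finset.card_union_le (univ.filter fun w => G.Adj u w ∧ S w < S u)
    (univ.filter fun w => G.Adj u w ∧ (-S) w < (-S) u)
  omega

lemma le_gonality {t : ℕ} (h : ∀ D : V → ℤ, ∀ d : ℕ, Effective D → PosRank G D →
    degDiv D = d → t ≤ d) : t ≤ gonality G := by
  refine le_csInf ⟨Fintype.card V, fun _ => 1, fun _ => zero_le_one, fun v => ?_, ?_⟩ ?_
  · exact ⟨fun _ => 1, fun _ => zero_le_one, ⟨0, by funext w; simp [lap]⟩, le_rfl⟩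
  · simp [degDiv]
  · rintro d ⟨D, hD, hr, hd⟩
    exact h D d hD hr hd

end Divisors

/-- Maximum principle: a function satisfying `(c + 2) F i ≤ F (i - 1) + F (i + 1)` inside an
interval and vanishing at its end points is nonpositive. -/
lemma nonpos_of_subharmonic {F : ℕ → ℤ} {c : ℤ} (hc : 1 ≤ c) {a b : ℕ}
    (hF : ∀ i, a < i → i < b → (c + 2) * F i ≤ F (i - 1) + F (i + 1)) (ha : F a = 0)
    (hb : F b = 0) : ∀ i, a ≤ i → i ≤ b → F i ≤ 0 := by
  intro i hai hib
  obtain ⟨j, hj, hmax⟩ := Finset.exists_max_image (Finset.Icc a b) F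
    ⟨i, Finset.mem_Icc.mpr ⟨hai, hib⟩⟩
  rw [Finset.mem_Icc] at hj
  refine (hmax i (Finset.mem_Icc.mpr ⟨hai, hib⟩)).trans ?_
  by_contra! hpos
  have hja : a ≠ j := by rintro rfl; omega
  have hjb : j ≠ b := by rintro rfl; omega
  have h1 := hF j (by omega) (by omega)
  have h2 := hmax (j - 1) (Finset.mem_Icc.mpr (by omega))
  have h3 := hmax (j + 1) (Finset.mem_Icc.mpr (by omega))
  nlinarith

/-- Strong maximum principle: such a function vanishes to the left of any interior zero. -/
lemma eq_zero_of_subharmonic {F : ℕ → ℤ} {c : ℤ} (hc : 1 ≤ c) {a b z : ℕ}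
    (hF : ∀ i, a < i → i < b → (c + 2) * F i ≤ F (i - 1) + F (i + 1)) (ha : F a = 0)
    (hb : F b = 0) (hzb : z < b) (hz : F z = 0) (e : ℕ) (he : a + e ≤ z) : F (z - e) = 0 := by
  have hnp := nonpos_of_subharmonic hc hF ha hb
  induction e with
  | zero => simpa using hz
  | succ e ih =>
    have h0 := ih (by omega)
    have h1 := hF (z - e) (by omega) (by omega)
    rw [h0, show z - e - 1 = z - (e + 1) by omega] at h1
    have h2 := hnp (z - (e + 1)) (by omega) (by omega)
    have h3 := hnp (z - e + 1) (by omega) (by omega)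
    omega

section ConedPath

/-- The path on the vertices `m, …, n - 1`, joined completely to the clique on `0, …, m - 1`. -/
def conedPath (m n : ℕ) : SimpleGraph (Fin n) where
  Adj i j := i ≠ j ∧ (i.val < m ∨ j.val < m ∨ i.val + 1 = j.val ∨ j.val + 1 = i.val)
  symm := ⟨fun i j h => ⟨h.1.symm, by have := h.2; tauto⟩⟩
  loopless := ⟨fun i h => h.1 rfl⟩

variable {m n : ℕ}

lemma conedPath_adj {i j : Fin n} : (conedPath m n).Adj i j ↔
    i ≠ j ∧ (i.val < m ∨ j.val < m ∨ i.val + 1 = j.val ∨ j.val + 1 = i.val) := Iff.rfl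

lemma conedPath_kConnected (hn : m + 2 ≤ n) : KConnected (conedPath m n) (m + 1) := by
  refine ⟨by rw [Fintype.card_fin]; omega, fun S hS => ?_⟩
  obtain ⟨w, hw⟩ : ∃ w, w ∉ S := by
    by_contra! hall
    have h := Finset.card_le_card (fun w _ => hall w : univ ⊆ S)
    rw [Finset.card_univ, Fintype.card_fin] at h
    omega
  by_cases hU : ∃ u : Fin n, u.val < m ∧ u ∉ S
  · obtain ⟨u, hu, huS⟩ := hU
    have hu' : u ∈ ((↑S : Set (Fin n))ᶜ) := by simpa using huS
    have key : ∀ x : ↥((↑S : Set (Fin n))ᶜ),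
        ((conedPath m n).induce ((↑S : Set (Fin n))ᶜ)).Reachable ⟨u, hu'⟩ x := by
      rintro ⟨x, hx⟩
      by_cases hux : u = x
      · subst hux
        exact Reachable.refl _
      · refine Adj.reachable ?_
        change (conedPath m n).Adj u x
        exact ⟨hux, Or.inl hu⟩
    have : Nonempty ↥((↑S : Set (Fin n))ᶜ) := ⟨⟨u, hu'⟩⟩
    exact ⟨fun x y => (key x).symm.trans (key y)⟩
  · push Not at hU
    have hsub : (Finset.range m).attachFin (n := n)
        (fun i hi => by rw [Finset.mem_range] at hi; omega) ⊆ S := by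
      intro u hu
      rw [Finset.mem_attachFin, Finset.mem_range] at hu
      exact hU u hu
    have heq := Finset.eq_of_subset_of_card_le hsub
      (by rw [Finset.card_attachFin, Finset.card_range]; omega)
    have hmem : ∀ i : Fin n, i ∈ ((↑S : Set (Fin n))ᶜ) ↔ m ≤ i.val := by
      intro i
      rw [← heq]
      simp
    refine induce_connected_of_ordConnected (fun i _ j _ hij => ?_) ⟨w, by simpa using hw⟩ ⟨?_⟩
    · exact ⟨by rintro rfl; omega, by omega⟩
    · intro i hi j _ z hz
      rw [hmem] at hi ⊢
      exact hi.trans (Fin.le_def.mp hz.1)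

lemma conedPath_exists_treeDecomp (hn : m + 2 ≤ n) :
    ∃ (l : ℕ) (T : SimpleGraph (Fin l)) (bag : Fin l → Finset (Fin n)),
      IsTreeDecomp (conedPath m n) T bag ∧ ∀ s, (bag s).card ≤ m + 1 + 1 := by
  let bag : Fin (n - m - 2 + 1) → Finset (Fin n) := fun s =>
    (Finset.range m ∪ {m + s.val, m + s.val + 1}).attachFin fun i hi => by
      have := s.2
      simp only [Finset.mem_union, Finset.mem_range, Finset.mem_insert, Finset.mem_singleton] at hi
      omega
  have hbag : ∀ v s, v ∈ bag s ↔ v.val < m ∨ v.val = m + s.val ∨ v.val = m + s.val + 1 := by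
    intro v s
    simp only [bag, Finset.mem_attachFin, Finset.mem_union, Finset.mem_range, Finset.mem_insert,
      Finset.mem_singleton]
  refine ⟨n - m - 2 + 1, pathGraph _, bag, ⟨pathGraph_isTree _, ?_, ?_, ?_⟩, ?_⟩
  · intro v
    have := v.2
    refine ⟨⟨v.val - m - 1, by omega⟩, ?_⟩
    rw [hbag]
    simp only
    omega
  · intro u v huv
    have h1 := u.2
    have h2 := v.2
    have h3 := huv.2
    by_cases hu : u.val < m
    · refine ⟨⟨v.val - m - 1, by omega⟩, ?_⟩
      rw [hbag, hbag]
      simp only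
      omega
    · by_cases hv : v.val < m
      · refine ⟨⟨u.val - m - 1, by omega⟩, ?_⟩
        rw [hbag, hbag]
        simp only
        omega
      · refine ⟨⟨min u.val v.val - m, by omega⟩, ?_⟩
        rw [hbag, hbag]
        simp only
        omega
  · intro v
    have := v.2
    refine induce_connected_of_ordConnected (fun i _ j _ hij => pathGraph_adj.mpr (Or.inl hij))
      ⟨⟨v.val - m - 1, by omega⟩, ?_⟩ ⟨?_⟩
    · rw [Set.mem_ofPred_eq, hbag]
      simp only
      omega
    · intro i hi j hj z hz
      have h1 := Fin.le_def.mp hz.1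
      have h2 := Fin.le_def.mp hz.2
      rw [Set.mem_ofPred_eq, hbag] at hi hj ⊢
      omega
  · intro s
    rw [Finset.card_attachFin]
    have h1 := Finset.card_union_le (Finset.range m) {m + s.val, m + s.val + 1}
    have h2 := Finset.card_le_two (a := m + s.val) (b := m + s.val + 1)
    rw [Finset.card_range] at h1
    omega

lemma conedPath_treewidth (hn : m + 2 ≤ n) : treewidth (conedPath m n) = m + 1 := by
  refine le_antisymm (Nat.sInf_le (conedPath_exists_treeDecomp hn)) ?_
  refine le_csInf ⟨_, conedPath_exists_treeDecomp hn⟩ ?_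
  rintro l ⟨_, T, bag, hdec, hl⟩
  exact (conedPath_kConnected hn).le_width hdec hl

/-- The Laplacian at an interior path vertex, for a function constant on the clique. -/
lemma lap_conedPath {S : Fin n → ℤ} {s : ℤ} (hs : ∀ u : Fin n, u.val < m → S u = s)
    {i : ℕ} (hi : m < i) (hin : i + 1 < n) :
    lap (conedPath m n) S ⟨i, by omega⟩ = m * (S ⟨i, by omega⟩ - s) +
      (S ⟨i, by omega⟩ - S ⟨i - 1, by omega⟩) + (S ⟨i, by omega⟩ - S ⟨i + 1, hin⟩) := by
  have hterm : ∀ w : Fin n,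
      (if (conedPath m n).Adj ⟨i, by omega⟩ w then S ⟨i, by omega⟩ - S w else 0) =
        (if w.val < m then S ⟨i, by omega⟩ - s else 0) +
        (if w = ⟨i - 1, by omega⟩ then S ⟨i, by omega⟩ - S w else 0) +
        (if w = ⟨i + 1, hin⟩ then S ⟨i, by omega⟩ - S w else 0) := by
    intro w
    have hw := hs w
    simp only [conedPath_adj, Fin.ext_iff, ne_eq]
    by_cases h1 : w.val < m
    · rw [if_pos (by omega), if_pos h1, if_neg (by omega), if_neg (by omega), hw h1]
      ring
    · by_cases h2 : w.val = i - 1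
      · rw [if_pos (by omega), if_neg h1, if_pos h2, if_neg (by omega)]
        ring
      · by_cases h3 : w.val = i + 1
        · rw [if_pos (by omega), if_neg h1, if_neg h2, if_pos h3]
          ring
        · rw [if_neg (by omega), if_neg h1, if_neg h2, if_neg h3]
          ring
  have hcard : (univ.filter fun w : Fin n => w.val < m).card = m := by
    have h : (univ.filter fun w : Fin n => w.val < m) = (Finset.range m).attachFin
        (fun j hj => by rw [Finset.mem_range] at hj; omega) := by
      ext w
      simp [Finset.mem_attachFin]
    rw [h, Finset.card_attachFin, Finset.card_range]
  rw [lap, Finset.sum_congr rfl fun w _ => hterm w, Finset.sum_add_distrib,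
    Finset.sum_add_distrib, Finset.sum_ite_eq', Finset.sum_ite_eq', ← Finset.sum_filter,
    Finset.sum_const, hcard, if_pos (mem_univ _), if_pos (mem_univ _), nsmul_eq_mul]

/-- A window of `4 t` path vertices contains one on which the firing script agrees with its values
at two given clique vertices. -/
lemma exists_eq_in_window {t d : ℕ} (hdt : d < t) {S D D' : Fin n → ℤ} (hD : Effective D)
    (hD' : Effective D') (hdeg : degDiv D = d) (hS : D' = D - lap (conedPath m n) S)
    {y : ℕ} (hy : m ≤ y) (hyn : y + 4 * t ≤ n) (u u' : Fin n) (hu : u.val < m)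
    (hu' : u'.val < m) :
    ∃ (i : ℕ) (hi : i < n), y ≤ i ∧ i < y + 4 * t ∧ S ⟨i, hi⟩ = S u ∧ S ⟨i, hi⟩ = S u' := by
  by_contra! hall
  have hsub : (Finset.Ico y (y + 4 * t)).attachFin (n := n)
      (fun i hi => by rw [Finset.mem_Ico] at hi; omega) ⊆
      (univ.filter fun w => (conedPath m n).Adj u w ∧ S w ≠ S u) ∪
        (univ.filter fun w => (conedPath m n).Adj u' w ∧ S w ≠ S u') := by
    intro w hw
    rw [Finset.mem_attachFin, Finset.mem_Ico] at hw
    have h := hall w.val w.2 hw.1 hw.2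
    have h1 : (conedPath m n).Adj u w := ⟨by rintro rfl; omega, Or.inl hu⟩
    have h2 : (conedPath m n).Adj u' w := ⟨by rintro rfl; omega, Or.inl hu'⟩
    simp only [mem_union, mem_filter, mem_univ, true_and, h1, h2]
    tauto
  have h1 := (Finset.card_le_card hsub).trans (Finset.card_union_le _ _)
  have h2 := card_adj_ne_le hD hD' hdeg hS u
  have h3 := card_adj_ne_le hD hD' hdeg hS u'
  rw [Finset.card_attachFin, Nat.card_Ico] at h1
  omega

/-- Among `t` consecutive blocks of length `L`, an effective divisor of degree less than `t`
vanishes on some block. -/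
lemma exists_zero_block {t d L : ℕ} (hdt : d < t) {D : Fin n → ℤ} (hD : Effective D)
    (hdeg : degDiv D = d) (y : ℕ) :
    ∃ x, y ≤ x ∧ x + L ≤ y + t * L ∧ ∀ v : Fin n, x ≤ v.val → v.val < x + L → D v = 0 := by
  by_contra! hall
  have hblock : ∀ b : Fin t, ∃ v : Fin n, y + b.val * L ≤ v.val ∧ v.val < y + b.val * L + L ∧
      D v ≠ 0 := by
    intro b
    refine hall (y + b.val * L) (by omega) ?_
    have h := Nat.mul_le_mul_right L (Nat.succ_le_of_lt b.2)
    rw [Nat.succ_mul] at h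
    omega
  choose p hp1 hp2 hp3 using hblock
  have hinj : Function.Injective p := by
    have hlt : ∀ b b' : Fin t, b.val < b'.val → p b ≠ p b' := by
      intro b b' hbb h
      have h1 := hp2 b
      have h2 := hp1 b'
      have h3 := Nat.mul_le_mul_right L (Nat.succ_le_of_lt hbb)
      rw [Nat.succ_mul] at h3
      rw [h] at h1
      omega
    intro b b' h
    rcases lt_trichotomy b.val b'.val with hb | hb | hb
    · exact absurd h (hlt b b' hb)
    · exact Fin.ext hb
    · exact absurd h.symm (hlt b' b hb)
  have hsum : ∑ b : Fin t, D (p b) ≤ d := by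
    rw [← hdeg, degDiv, ← Finset.sum_image (f := D) (g := p) hinj.injOn]
    exact Finset.sum_le_sum_of_subset_of_nonneg (subset_univ _) fun v _ _ => hD v
  have hone : ∑ _b : Fin t, (1 : ℤ) ≤ ∑ b : Fin t, D (p b) :=
    Finset.sum_le_sum fun b _ => by
      have h1 := hD (p b)
      have h2 := hp3 b
      omega
  simp only [Finset.sum_const, Finset.card_univ, Fintype.card_fin, nsmul_eq_mul, mul_one] at hone
  omega

lemma le_gonality_conedPath {t : ℕ} (hm : 1 ≤ m) (hn : n = m + 1 + t * (12 * t + 1) + 1) :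
    t ≤ gonality (conedPath m n) := by
  refine le_gonality fun D d hD hrank hdeg => ?_
  by_contra! hdt
  obtain ⟨x, hx, hxL, hzero⟩ := exists_zero_block (L := 12 * t + 1) hdt hD hdeg (m + 1)
  obtain ⟨D', hD', ⟨S, hS⟩, hpos⟩ := hrank ⟨x + 4 * t, by omega⟩
  set u₀ : Fin n := ⟨0, by omega⟩
  set s := S u₀
  have hu₀ : u₀.val < m := hm
  have hconst : ∀ u : Fin n, u.val < m → S u = s := by
    intro u hu
    obtain ⟨i, hi, -, -, h1, h2⟩ := exists_eq_in_window hdt hD hD' hdeg hS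
      (y := x) (by omega) (by omega) u u₀ hu hu₀
    exact h1.symm.trans h2
  let F : ℕ → ℤ := fun i => if h : i < n then S ⟨i, h⟩ - s else 0
  have hwin : ∀ y, m ≤ y → y + 4 * t ≤ n → ∃ i, y ≤ i ∧ i < y + 4 * t ∧ F i = 0 := by
    intro y hy hyn
    obtain ⟨i, hi, h1, h2, h3, -⟩ := exists_eq_in_window hdt hD hD' hdeg hS hy hyn u₀ u₀ hu₀ hu₀
    exact ⟨i, h1, h2, by simp only [F, dif_pos hi, h3, s, sub_self]⟩
  have hval : ∀ i (h1 : x ≤ i) (h2 : i < x + (12 * t + 1)),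
      D' ⟨i, by omega⟩ = F (i - 1) + F (i + 1) - (m + 2) * F i := by
    intro i h1 h2
    rw [hS, Pi.sub_apply, hzero ⟨i, by omega⟩ h1 h2, lap_conedPath hconst (by omega) (by omega)]
    simp only [F, dif_pos (show i - 1 < n by omega), dif_pos (show i + 1 < n by omega),
      dif_pos (show i < n by omega)]
    ring
  have hsub : ∀ i, x ≤ i → i < x + (12 * t + 1) → ((m : ℤ) + 2) * F i ≤ F (i - 1) + F (i + 1) := by
    intro i h1 h2
    have h3 := hval i h1 h2
    have h4 := hD' ⟨i, by omega⟩
    omega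
  have hc : (1 : ℤ) ≤ m := by exact_mod_cast hm
  obtain ⟨a, ha1, ha2, ha⟩ := hwin x (by omega) (by omega)
  obtain ⟨z, hz1, hz2, hz⟩ := hwin (x + 4 * t + 1) (by omega) (by omega)
  obtain ⟨b, hb1, hb2, hb⟩ := hwin (x + 8 * t + 1) (by omega) (by omega)
  have hF : ∀ i, a < i → i < b → ((m : ℤ) + 2) * F i ≤ F (i - 1) + F (i + 1) :=
    fun i h1 h2 => hsub i (by omega) (by omega)
  have hleft := eq_zero_of_subharmonic hc hF ha hb (by omega : z < b) hz
  have h0 := hleft (z - (x + 4 * t)) (by omega)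
  rw [show z - (z - (x + 4 * t)) = x + 4 * t by omega] at h0
  have hnp := nonpos_of_subharmonic hc hF ha hb
  have h1 := hnp (x + 4 * t - 1) (by omega) (by omega)
  have h2 := hnp (x + 4 * t + 1) (by omega) (by omega)
  rw [hval (x + 4 * t) (by omega) (by omega), h0] at hpos
  omega

end ConedPath

/-- For all integers `k ≥ 2` and `t ≥ k`, there exists a `k`-connected graph `G`
with treewidth exactly `k` and gonality at least `t`. -/
theorem stmt_0 (k t : ℕ) (hk : 2 ≤ k) (ht : k ≤ t) :
    ∃ (n : ℕ) (G : SimpleGraph (Fin n)),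
      KConnected G k ∧ treewidth G = k ∧ t ≤ gonality G := by
  obtain ⟨m, rfl⟩ : ∃ m, k = m + 1 := ⟨k - 1, by omega⟩
  have hn : m + 2 ≤ m + 1 + t * (12 * t + 1) + 1 := by omega
  exact ⟨m + 1 + t * (12 * t + 1) + 1, conedPath m _, conedPath_kConnected hn,
    conedPath_treewidth hn, le_gonality_conedPath (by omega) rfl⟩
end
end

section
/- If D and D' are equivalent effective divisors on a connected finite simple graph G, then there is a unique chain of sets A_1 ⊆ A_2 ⊆ ⋯ ⊆ A_t with ∅ ⊊ A_1 and A_t ⊊ V(G), together with divisors D_0, D_1, …, D_t, such that D_0 = D, D_t = D', and for all i ∈ {1,…,t}, D_i is effective and D_i = D_{i−1} − Q·1_{A_i}, where 1_{A_i} denotes the 0/1 indicator vector of A_i. -/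
open SimpleGraph Finset
open scoped Classical

noncomputable section

theorem lap_sub {V : Type} [Fintype V] (G : SimpleGraph V) (S T : V → ℤ) :
    lap G (S - T) = lap G S - lap G T := by
  funext v
  simp only [lap, Pi.sub_apply, ← Finset.sum_sub_distrib]
  refine Finset.sum_congr rfl fun w _ => ?_
  split_ifs <;> ring

theorem lap_sub_const {V : Type} [Fintype V] (G : SimpleGraph V) (S : V → ℤ) (c : ℤ) :
    lap G (fun v => S v - c) = lap G S := by
  funext v
  simp [lap]

theorem lap_le_lap {V : Type} [Fintype V] (G : SimpleGraph V) {S T : V → ℤ} {v : V}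
    (h : ∀ w, S v - S w ≤ T v - T w) : lap G S v ≤ lap G T v := by
  refine Finset.sum_le_sum fun w _ => ?_
  split_ifs
  · exact h w
  · exact le_rfl

/-- A function with vanishing Laplacian on a connected graph is constant. -/
theorem exists_eq_const_of_lap_eq_zero {V : Type} [Fintype V] {G : SimpleGraph V}
    (hG : G.Connected) {F : V → ℤ} (h : lap G F = 0) : ∃ c, ∀ v, F v = c := by
  have := hG.nonempty
  obtain ⟨m, hm⟩ := Finite.exists_max F
  refine ⟨F m, fun v => ?_⟩
  obtain ⟨p⟩ := hG.preconnected v m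
  induction p with
  | nil => rfl
  | @cons u w m hadj _ ih =>
    have hw := ih hm
    have h0 : ∑ x : V, (if G.Adj w x then F w - F x else 0) = 0 := congrFun h w
    rw [Finset.sum_eq_zero_iff_of_nonneg] at h0
    · have := h0 u (Finset.mem_univ u)
      rw [if_pos hadj.symm] at this
      linarith
    · intro x _
      have := hm x
      split_ifs <;> linarith

/-- If two functions with minimum `0` have the same Laplacian on a connected graph, they agree. -/
theorem eq_of_lap_eq {V : Type} [Fintype V] {G : SimpleGraph V}
    (hG : G.Connected) {S T : V → ℤ} (h : lap G S = lap G T)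
    (hS : ∀ v, 0 ≤ S v) (hS' : ∃ v, S v = 0) (hT : ∀ v, 0 ≤ T v) (hT' : ∃ v, T v = 0) :
    S = T := by
  obtain ⟨c, hc⟩ := exists_eq_const_of_lap_eq_zero hG
    (F := S - T) (by rw [lap_sub, h, sub_self])
  simp only [Pi.sub_apply] at hc
  obtain ⟨a, ha⟩ := hS'
  obtain ⟨b, hb⟩ := hT'
  funext v
  have h1 := hc a
  have h2 := hc b
  have h3 := hc v
  have h4 := hT a
  have h5 := hS b
  linarith

theorem sum_range_threshold {a t : ℕ} (h : a ≤ t) (n : ℕ) :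
    ∑ j ∈ Finset.range n, (if t ≤ a + j then (1 : ℤ) else 0) = ((n + a - t : ℕ) : ℤ) := by
  induction n with
  | zero => simp; omega
  | succ n ih =>
    rw [Finset.sum_range_succ, ih]
    split_ifs <;> omega

theorem sum_filter_le_eq_sum_range {t : ℕ} (i : Fin t) (f : ℕ → ℤ) :
    ∑ j ∈ Finset.univ.filter (fun j : Fin t => j ≤ i), f j
      = ∑ j ∈ Finset.range (i + 1), f j := by
  refine Finset.sum_bij (fun j _ => (j : ℕ)) ?_ ?_ ?_ ?_
  · intro j hj
    simp only [Finset.mem_filter, Fin.le_def] at hj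
    simp only [Finset.mem_range]
    omega
  · intro a _ b _ hab
    exact Fin.ext hab
  · intro b hb
    simp only [Finset.mem_range] at hb
    refine ⟨⟨b, by omega⟩, ?_, rfl⟩
    simp only [Finset.mem_filter, Finset.mem_univ, true_and, Fin.le_def]
    omega
  · intro a _
    rfl

theorem indic_threshold {V : Type} (T : V → ℕ) (t j : ℕ) (v : V) :
    indic {w | t ≤ T w + j} v = if t ≤ T v + j then 1 else 0 := by
  simp [indic]

theorem indic_nonneg {V : Type} (A : Set V) (v : V) : 0 ≤ indic A v := by
  unfold indic
  split_ifs <;> norm_num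

theorem indic_le_one {V : Type} (A : Set V) (v : V) : indic A v ≤ 1 := by
  unfold indic
  split_ifs <;> norm_num

theorem sum_indic_le {V : Type} {t : ℕ} (A : Fin t → Set V) (v : V) :
    ∑ j, indic (A j) v ≤ t := by
  simpa using Finset.sum_le_sum fun j (_ : j ∈ Finset.univ) => indic_le_one (A j) v

/-- The sum of the indicators of a chain determines each member of the chain. -/
theorem mem_chain_iff {V : Type} {t : ℕ} {A : Fin t → Set V}
    (hA : ∀ i j, i ≤ j → A i ⊆ A j) (i : Fin t) (v : V) :
    v ∈ A i ↔ (t : ℤ) ≤ ∑ j, indic (A j) v + i := by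
  have hi := i.isLt
  constructor
  · intro hv
    have h1 : ∑ j ∈ Finset.Ici i, (1 : ℤ) ≤ ∑ j ∈ Finset.Ici i, indic (A j) v := by
      refine Finset.sum_le_sum fun j hj => ?_
      rw [indic, if_pos (hA i j (Finset.mem_Ici.mp hj) hv)]
    have h2 : ∑ j ∈ Finset.Ici i, indic (A j) v ≤ ∑ j, indic (A j) v :=
      Finset.sum_le_sum_of_subset_of_nonneg (Finset.subset_univ _)
        fun j _ _ => indic_nonneg _ _
    rw [Finset.sum_const, Fin.card_Ici, nsmul_eq_mul, mul_one] at h1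
    omega
  · intro h
    by_contra hv
    have h1 : ∑ j ∈ Finset.Ioi i, indic (A j) v = ∑ j, indic (A j) v := by
      refine Finset.sum_subset (Finset.subset_univ _) fun j _ hj => ?_
      rw [indic, if_neg fun hj' => hv (hA j i (by simpa using hj) hj')]
    have h2 : ∑ j ∈ Finset.Ioi i, indic (A j) v ≤ ∑ j ∈ Finset.Ioi i, (1 : ℤ) :=
      Finset.sum_le_sum fun j _ => indic_le_one _ _
    rw [Finset.sum_const, Fin.card_Ioi, nsmul_eq_mul, mul_one] at h2
    omega

theorem exists_sum_indic_eq_zero {V : Type} [Nonempty V] {t : ℕ} {A : Fin t → Set V}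
    (hA : ∀ i j, i ≤ j → A i ⊆ A j) (hA' : ∀ i, A i ≠ Set.univ) :
    ∃ v, ∑ j, indic (A j) v = 0 := by
  cases t with
  | zero => simp
  | succ t =>
    obtain ⟨v, hv⟩ := (Set.ne_univ_iff_exists_notMem _).mp (hA' (Fin.last t))
    refine ⟨v, Finset.sum_eq_zero fun j _ => ?_⟩
    rw [indic, if_neg fun h => hv (hA j _ (Fin.le_last j) h)]

theorem exists_sum_indic_eq_length {V : Type} [Nonempty V] {t : ℕ} {A : Fin t → Set V}
    (hA : ∀ i j, i ≤ j → A i ⊆ A j) (hA' : ∀ i, (A i).Nonempty) :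
    ∃ v, ∑ j, indic (A j) v = t := by
  cases t with
  | zero => simp
  | succ t =>
    obtain ⟨v, hv⟩ := hA' 0
    refine ⟨v, ?_⟩
    have h : ∀ j, indic (A j) v = 1 := fun j => by
      rw [indic, if_pos (hA 0 j (Fin.zero_le j) hv)]
    simp [h]

/-- A chain of nonempty proper subsets is determined by the Laplacian of its indicator sum. -/
theorem chain_eq_of_lap_eq {V : Type} [Fintype V] {G : SimpleGraph V} (hG : G.Connected)
    {s t : ℕ} {A : Fin s → Set V} {B : Fin t → Set V}
    (hA : ∀ i j, i ≤ j → A i ⊆ A j) (hA' : ∀ i, (A i).Nonempty) (hA'' : ∀ i, A i ≠ Set.univ)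
    (hB : ∀ i j, i ≤ j → B i ⊆ B j) (hB' : ∀ i, (B i).Nonempty) (hB'' : ∀ i, B i ≠ Set.univ)
    (h : lap G (fun v => ∑ j, indic (A j) v) = lap G (fun v => ∑ j, indic (B j) v)) :
    (⟨s, A⟩ : Σ t : ℕ, Fin t → Set V) = ⟨t, B⟩ := by
  have := hG.nonempty
  have key := eq_of_lap_eq hG h
    (fun v => Finset.sum_nonneg fun j _ => indic_nonneg _ _) (exists_sum_indic_eq_zero hA hA'')
    (fun v => Finset.sum_nonneg fun j _ => indic_nonneg _ _) (exists_sum_indic_eq_zero hB hB'')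
  have hst : s = t := by
    obtain ⟨a, ha⟩ := exists_sum_indic_eq_length hA hA'
    obtain ⟨b, hb⟩ := exists_sum_indic_eq_length hB hB'
    have h1 := congrFun key a
    have h2 := congrFun key b
    have h3 := sum_indic_le B a
    have h4 := sum_indic_le A b
    omega
  subst hst
  congr 1
  funext i
  ext v
  rw [mem_chain_iff hA, mem_chain_iff hB, show ∑ j, indic (A j) v = _ from congrFun key v]

/-- Truncating a firing script from below keeps the divisor effective. -/
theorem effective_sub_lap_truncate {V : Type} [Fintype V] (G : SimpleGraph V)
    {D S : V → ℤ} (hD : Effective D) (hS : Effective (D - lap G S)) (c : ℤ) :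
    Effective (D - lap G (fun v => max 0 (S v - c))) := by
  intro v
  have h1 := hD v
  have h2 := hS v
  simp only [Pi.sub_apply] at h2 ⊢
  rcases le_total (S v) c with h | h
  · have h3 : lap G (fun v => max 0 (S v - c)) v ≤ lap G (fun _ => 0) v :=
      lap_le_lap G fun w => by grind
    have h4 : lap G (fun _ => 0) v = 0 := by simp [lap]
    linarith
  · have h3 : lap G (fun v => max 0 (S v - c)) v ≤ lap G S v :=
      lap_le_lap G fun w => by grind
    linarith

/-- If `D` and `D'` are equivalent effective divisors of a connected graph `G`, then
there is a unique chain `∅ ⊊ A 0 ⊆ A 1 ⊆ ⋯ ⊆ A (t-1) ⊊ V(G)` together with the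
corresponding sequence of divisors `D = D_0, D_1, …, D_t = D'` (determined by
`D_i = D_{i-1} - Q·1_{A i}`) such that each `D_i` is effective. -/
theorem stmt_1 {V : Type} [Fintype V] (G : SimpleGraph V) (hG : G.Connected)
    (D D' : V → ℤ) (hD : Effective D) (hD' : Effective D') (hDD' : LinEquiv G D D') :
    ∃! p : Σ t : ℕ, Fin t → Set V,
      (∀ i j : Fin p.1, i ≤ j → p.2 i ⊆ p.2 j) ∧
      (∀ i : Fin p.1, (p.2 i).Nonempty) ∧
      (∀ i : Fin p.1, p.2 i ≠ Set.univ) ∧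
      (∀ i : Fin p.1,
        Effective (D - lap G (fun v => ∑ j ∈ Finset.univ.filter (fun j : Fin p.1 => j ≤ i),
          indic (p.2 j) v))) ∧
      D' = D - lap G (fun v => ∑ j : Fin p.1, indic (p.2 j) v) := by
  have := hG.nonempty
  obtain ⟨S, hS⟩ := hDD'
  obtain ⟨m, hm⟩ := Finite.exists_min S
  obtain ⟨T, hT⟩ : ∃ T : V → ℕ, ∀ v, (T v : ℤ) = S v - S m :=
    ⟨fun v => (S v - S m).toNat, fun v => Int.toNat_of_nonneg (by linarith [hm v])⟩
  have hTm : T m = 0 := by have := hT m; omega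
  have hlap : D' = D - lap G (fun v => (T v : ℤ)) := by
    simp only [hT, lap_sub_const, hS]
  obtain ⟨M, hM⟩ := Finite.exists_max T
  have hsum (v : V) : ∑ j : Fin (T M), indic {w | T M ≤ T w + j} v = T v := by
    have h := sum_range_threshold (hM v) (T M)
    rw [← Fin.sum_univ_eq_sum_range (fun j => if T M ≤ T v + j then (1 : ℤ) else 0),
      Nat.add_sub_cancel_left] at h
    simpa only [indic_threshold] using h
  have hpartial (i : Fin (T M)) (v : V) :
      ∑ j ∈ Finset.univ.filter (fun j : Fin (T M) => j ≤ i), indic {w | T M ≤ T w + j} v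
        = max 0 ((T v : ℤ) - (T M - 1 - i)) := by
    have h := sum_range_threshold (hM v) (i + 1)
    rw [← sum_filter_le_eq_sum_range i (fun j => if T M ≤ T v + j then (1 : ℤ) else 0)] at h
    simp only [indic_threshold, h]
    omega
  have hmono : ∀ i j : Fin (T M), i ≤ j → {w | T M ≤ T w + i} ⊆ {w | T M ≤ T w + j} := by
    intro i j hij w hw
    simp only [Set.mem_ofPred_eq, Fin.le_def] at *
    omega
  have hne : ∀ i : Fin (T M), {w | T M ≤ T w + i}.Nonempty := fun i => ⟨M, by simp⟩
  have hproper : ∀ i : Fin (T M), {w | T M ≤ T w + i} ≠ Set.univ := by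
    intro i hi
    have h : m ∈ {w | T M ≤ T w + i} := hi ▸ Set.mem_univ m
    simp only [Set.mem_ofPred_eq] at h
    omega
  refine ⟨⟨T M, fun i => {w | T M ≤ T w + i}⟩, ⟨hmono, hne, hproper, fun i => ?_, ?_⟩, ?_⟩
  · simp only [hpartial]
    exact effective_sub_lap_truncate G hD (hlap ▸ hD') _
  · simpa only [hsum] using hlap
  · rintro ⟨t, B⟩ ⟨hB, hB', hB'', -, hBD⟩
    refine chain_eq_of_lap_eq hG hB hB' hB'' hmono hne hproper ?_
    simp only [hsum]
    exact sub_right_injective (hBD.symm.trans hlap)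
end
end

section
/- Let D be an effective divisor of a finite simple graph G and let A ⊆ V(G) be such that D − Q·1_A is also an effective divisor. Then for every subgraph H of G and every vertex w ∈ V(H) \ A, we have clump(H, D|_H, w) ⊆ V(H) \ A. -/
open SimpleGraph Finset
open scoped Classical

noncomputable section

/-- The clump centred at `v`: the intersection of all sets `S` containing `v`
such that `D w ≥ |N(w) ∩ S|` for every vertex `w ∉ S`. -/
def clump {V : Type} (G : SimpleGraph V) (D : V → ℤ) (v : V) : Set V :=
  ⋂₀ {S : Set V | v ∈ S ∧ ∀ w ∉ S, ((G.neighborSet w ∩ S).ncard : ℤ) ≤ D w}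

theorem lap_indic_of_mem {V : Type} [Fintype V] (G : SimpleGraph V) {A : Set V} {v : V}
    (hv : v ∈ A) : lap G (indic A) v = ((G.neighborSet v \ A).ncard : ℤ) := by
  have h : G.neighborSet v \ A = ↑(univ.filter fun u => G.Adj v u ∧ u ∉ A) := by
    ext u
    simp
  rw [h, Set.ncard_coe_finset, Finset.card_filter]
  push_cast
  refine Finset.sum_congr rfl fun u _ => ?_
  by_cases hu : u ∈ A <;> simp [indic, hv, hu]

/-- If `D` is an effective divisor of `G` and `A ⊆ V(G)` is such that `D - Q·1_A`
is also effective, then for every subgraph `H` of `G` and every vertex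
`w ∈ V(H) \ A`, the clump `clump(H, D|_H, w)` is contained in `V(H) \ A`. -/
theorem stmt_3 {V : Type} [Fintype V] (G : SimpleGraph V) (D : V → ℤ)
    (hD : Effective D) (A : Set V) (hA : Effective (D - lap G (indic A)))
    (H : G.Subgraph) (w : V) (hwH : w ∈ H.verts) (hwA : w ∉ A) :
    ∀ x ∈ clump H.coe (fun y : ↥H.verts => D y.val) ⟨w, hwH⟩, (x : V) ∉ A := by
  intro x hx
  refine Set.mem_sInter.mp hx {y | (y : V) ∉ A} ⟨hwA, fun y hy => ?_⟩
  have hyA : (y : V) ∈ A := not_not.mp hy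
  have hlap : lap G (indic A) y ≤ D y := sub_nonneg.mp (hA y)
  rw [lap_indic_of_mem G hyA] at hlap
  refine le_trans (Int.ofNat_le.mpr ?_) hlap
  exact Set.ncard_le_ncard_of_injOn Subtype.val (fun u hu => ⟨H.adj_sub hu.1, hu.2⟩)
    Subtype.val_injective.injOn (Set.toFinite _)
end
end

section
/- Let G be a connected finite simple graph and let H be a subgraph of G with |V(H)| ≥ 2. If H has a universal vertex (a vertex adjacent in H to every other vertex of H), then gon(H) ≤ gon(G). -/
open SimpleGraph Finset
open scoped Classical

noncomputable section

theorem lap_add {V : Type} [Fintype V] (G : SimpleGraph V) (S T : V → ℤ) :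
    lap G (S + T) = lap G S + lap G T := by
  funext v
  simp only [lap, Pi.add_apply, ← Finset.sum_add_distrib]
  refine Finset.sum_congr rfl fun w _ => ?_
  split_ifs <;> ring

theorem degDiv_lap {V : Type} [Fintype V] (G : SimpleGraph V) (S : V → ℤ) :
    degDiv (lap G S) = 0 := by
  have h : degDiv (lap G S) = -degDiv (lap G S) := by
    conv_lhs => simp only [degDiv, lap]
    rw [Finset.sum_comm]
    simp only [degDiv, lap, ← Finset.sum_neg_distrib]
    refine Finset.sum_congr rfl fun v _ => Finset.sum_congr rfl fun w _ => ?_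
    simp only [G.adj_comm w v]
    split_ifs <;> ring
  omega

theorem lap_nonneg_of_forall_le {V : Type} [Fintype V] (G : SimpleGraph V) {S : V → ℤ} {v : V}
    (hv : ∀ w, S w ≤ S v) : 0 ≤ lap G S v := by
  refine Finset.sum_nonneg fun w _ => ?_
  have := hv w
  split_ifs <;> omega

/-- On the set where `S` is maximal, firing that set once costs no more than firing `S`. -/
theorem lap_indic_argmax_le {V : Type} [Fintype V] (G : SimpleGraph V) {S : V → ℤ} {v : V}
    (hv : ∀ w, S w ≤ S v) : lap G (indic {x | ∀ w, S w ≤ S x}) v ≤ lap G S v := by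
  refine Finset.sum_le_sum fun w _ => ?_
  split_ifs with h
  · have hw := hv w
    by_cases hmax : ∀ x, S x ≤ S w
    · simp [indic, hmax, hv]
    · have hne : S w ≠ S v := fun he => hmax fun x => he ▸ hv x
      simp only [indic, Set.mem_ofPred_eq, hmax, hv, implies_true, if_true, if_false]
      omega
  · exact le_rfl

theorem lap_indic_nonpos_of_notMem {V : Type} [Fintype V] (G : SimpleGraph V) {A : Set V} {v : V}
    (hv : v ∉ A) : lap G (indic A) v ≤ 0 := by
  refine Finset.sum_nonpos fun w _ => ?_
  simp only [indic, hv, if_false]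
  split_ifs <;> omega

theorem lap_indic_le_neg_one_of_adj {V : Type} [Fintype V] (G : SimpleGraph V) {A : Set V}
    {u v : V} (hu : u ∈ A) (hv : v ∉ A) (h : G.Adj v u) : lap G (indic A) v ≤ -1 := by
  have key : lap G (indic A) v ≤ ∑ w : V, if w = u then (-1 : ℤ) else 0 := by
    refine Finset.sum_le_sum fun w _ => ?_
    by_cases hw : w = u
    · subst hw
      simp [indic, hu, hv, h]
    · simp only [indic, hv, hw, if_false]
      split_ifs <;> omega
  simpa using key

theorem effective_sub_lap_argmax {V : Type} [Fintype V] (G : SimpleGraph V) {D S : V → ℤ}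
    (hD : Effective D) (hS : Effective (D - lap G S)) :
    Effective (D - lap G (indic {x | ∀ w, S w ≤ S x})) := by
  intro v
  have h0 := hD v
  have h1 := hS v
  simp only [Pi.sub_apply] at h1 ⊢
  by_cases hv : ∀ w, S w ≤ S v
  · have := lap_indic_argmax_le G hv
    omega
  · have := lap_indic_nonpos_of_notMem G (A := {x | ∀ w, S w ≤ S x}) hv
    omega

theorem eq_of_lap_eq_zero {V : Type} [Fintype V] {G : SimpleGraph V} (hG : G.Connected)
    {S : V → ℤ} (hS : lap G S = 0) (a b : V) : S a = S b := by
  obtain ⟨m, -, hm⟩ := Finset.exists_max_image Finset.univ S ⟨a, Finset.mem_univ a⟩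
  have step : ∀ {x y : V}, G.Adj x y → S x = S m → S y = S m := by
    intro x y hxy hx
    have hsum : ∑ w : V, (if G.Adj x w then S x - S w else 0) = 0 := congrFun hS x
    rw [Finset.sum_eq_zero_iff_of_nonneg] at hsum
    · have := hsum y (Finset.mem_univ y)
      rw [if_pos hxy] at this
      omega
    · intro w _
      have := hm w (Finset.mem_univ w)
      split_ifs <;> omega
  have all : ∀ x, S x = S m := by
    intro x
    obtain ⟨p⟩ := hG.preconnected m x
    have walk : ∀ {y z : V}, G.Walk y z → S y = S m → S z = S m := by
      intro y z q
      induction q with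
      | nil => exact id
      | cons h _ ih => exact fun hy => ih (step h hy)
    exact walk p rfl
  rw [all a, all b]

theorem finite_setOf_effective_degDiv_eq {V : Type} [Fintype V] (d : ℤ) :
    {D : V → ℤ | Effective D ∧ degDiv D = d}.Finite := by
  refine (Set.finite_Icc (0 : V → ℤ) fun _ => d).subset ?_
  rintro D ⟨hD, rfl⟩
  exact ⟨hD, fun v => Finset.single_le_sum (fun w _ => hD w) (Finset.mem_univ v)⟩

/-- Existence of a `u`-reduced divisor: every effective divisor equivalent to it is reached by
a firing script which is maximal at `u`. -/
theorem exists_reduced {V : Type} [Fintype V] {G : SimpleGraph V} (hG : G.Connected)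
    {D : V → ℤ} (hD : Effective D) (u : V) :
    ∃ S : V → ℤ, Effective (D - lap G S) ∧
      ∀ T : V → ℤ, Effective (D - lap G S - lap G T) → ∀ w, T w ≤ T u := by
  let scripts : Set (V → ℤ) := {S | S u = 0 ∧ Effective (D - lap G S)}
  have hfin : scripts.Finite := by
    refine Set.Finite.of_finite_image (f := fun S => D - lap G S)
      ((finite_setOf_effective_degDiv_eq (degDiv D)).subset ?_) ?_
    · rintro _ ⟨S, hS, rfl⟩
      refine ⟨hS.2, ?_⟩
      have := degDiv_lap G S
      simp only [degDiv, Pi.sub_apply, Finset.sum_sub_distrib] at this ⊢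
      omega
    · intro S hS T hT h
      have h0 : lap G (S - T) = 0 := by
        rw [lap_sub, sub_eq_zero]
        exact sub_right_injective h
      funext v
      have := eq_of_lap_eq_zero hG h0 v u
      simp only [Pi.sub_apply, hS.1, hT.1] at this
      omega
  have hne : scripts.Nonempty := by
    refine ⟨0, rfl, ?_⟩
    have : lap G 0 = 0 := by funext v; simp [lap]
    rwa [this, sub_zero]
  obtain ⟨S, hS, hmax⟩ := Set.exists_max_image scripts (fun S => ∑ v, S v) hfin hne
  refine ⟨S, hS.2, fun T hT => ?_⟩
  by_contra hu
  let A : Set V := {x | ∀ w, T w ≤ T x}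
  have hA : S + indic A ∈ scripts := by
    refine ⟨by simp [hS.1, indic, A, hu], ?_⟩
    rw [lap_add, ← sub_sub]
    exact effective_sub_lap_argmax G hS.2 hT
  obtain ⟨m, -, hm⟩ := Finset.exists_max_image Finset.univ T ⟨u, Finset.mem_univ u⟩
  have hmA : m ∈ A := fun w => hm w (Finset.mem_univ w)
  have hle := hmax _ hA
  have hpos : 0 < ∑ v, indic A v :=
    Finset.sum_pos' (fun v _ => by unfold indic; split_ifs <;> omega)
      ⟨m, Finset.mem_univ m, by simp [indic, hmA]⟩
  simp only [Pi.add_apply, Finset.sum_add_distrib] at hle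
  omega

theorem sum_subtype_le_sum {V : Type} [Fintype V] (s : Set V) [Fintype s] {f : V → ℤ}
    (hf : ∀ v, 0 ≤ f v) : ∑ v : s, f v ≤ ∑ v, f v := by
  have h := Finset.sum_map (Finset.univ : Finset s) (Function.Embedding.subtype (· ∈ s)) f
  simp only [Function.Embedding.subtype_apply] at h
  rw [← h]
  exact Finset.sum_le_sum_of_subset_of_nonneg (Finset.subset_univ _) fun v _ _ => hf v

theorem lap_coe_indic_le {V : Type} [Fintype V] {G : SimpleGraph V} (H : G.Subgraph)
    [Fintype H.verts] {A : Set V} (v : H.verts) (hv : (v : V) ∈ A) :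
    lap H.coe (indic (Subtype.val ⁻¹' A)) v ≤ lap G (indic A) v := by
  have hterm : ∀ w : V, 0 ≤ indic A v - indic A w := by
    intro w
    simp only [indic, hv, if_true]
    split_ifs <;> omega
  refine le_trans (Finset.sum_le_sum fun w _ => ?_) (sum_subtype_le_sum H.verts
    (f := fun w => if G.Adj v w then indic A v - indic A w else 0) fun w => ?_)
  · have hw := hterm w
    change (if H.Adj v w then indic A v - indic A w else 0) ≤ _
    by_cases h : H.Adj v w
    · simp [h, h.adj_sub]
    · rw [if_neg h]
      split_ifs <;> omega
  · have hw := hterm w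
    split_ifs <;> omega

theorem exists_effective_posRank_degDiv_eq_gonality {V : Type} [Fintype V] (G : SimpleGraph V) :
    ∃ D : V → ℤ, Effective D ∧ PosRank G D ∧ degDiv D = (gonality G : ℤ) := by
  refine Nat.sInf_mem (s := {n : ℕ | ∃ D : V → ℤ, Effective D ∧ PosRank G D ∧
    degDiv D = (n : ℤ)}) ⟨Fintype.card V, 1, fun _ => zero_le_one, fun v => ?_, by simp [degDiv]⟩
  exact ⟨1, fun _ => zero_le_one, ⟨0, by funext v; simp [lap]⟩, le_rfl⟩

theorem gonality_le_of_posRank {V : Type} [Fintype V] {G : SimpleGraph V} {D : V → ℤ} {n : ℕ}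
    (hD : Effective D) (hr : PosRank G D) (hn : degDiv D ≤ n) : gonality G ≤ n := by
  have h0 : 0 ≤ degDiv D := Finset.sum_nonneg fun v _ => hD v
  have h1 : gonality G ≤ (degDiv D).toNat :=
    Nat.sInf_le ⟨D, hD, hr, (Int.toNat_of_nonneg h0).symm⟩
  omega

/-- If `G` is a connected graph and `H` is a subgraph of `G` with at least two
vertices having a universal vertex, then `gon(H) ≤ gon(G)`. -/
theorem stmt_6 {V : Type} [Fintype V] (G : SimpleGraph V) (hG : G.Connected)
    (H : G.Subgraph) (hcard : 2 ≤ H.verts.ncard)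
    (huniv : ∃ v ∈ H.verts, ∀ w ∈ H.verts, w ≠ v → H.Adj v w) :
    gonality H.coe ≤ gonality G := by
  obtain ⟨u, huH, hu⟩ := huniv
  obtain ⟨D₀, hD₀, hrank, hdeg⟩ := exists_effective_posRank_degDiv_eq_gonality G
  obtain ⟨S, hS, hred⟩ := exists_reduced hG hD₀ u
  set D := D₀ - lap G S with hD
  have hdegD : degDiv D = gonality G := by
    have := degDiv_lap G S
    simp only [hD, degDiv, Pi.sub_apply, Finset.sum_sub_distrib] at this hdeg ⊢
    omega
  refine gonality_le_of_posRank (D := fun v : H.verts => D v) (fun v => hS v) (fun w => ?_)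
    ((sum_subtype_le_sum H.verts hS).trans hdegD.le)
  obtain ⟨D', hD', ⟨T', rfl⟩, hw⟩ := hrank w
  have hT : D₀ - lap G T' = D - lap G (T' - S) := by
    rw [lap_sub, hD]
    abel
  rw [hT] at hD' hw
  set T := T' - S
  have hTu := hred T hD'
  let A : Set V := {x | ∀ y, T y ≤ T x}
  by_cases hwA : (w : V) ∈ A
  · have hnonneg := lap_nonneg_of_forall_le G hwA
    refine ⟨fun v => D v, fun v => hS v, ⟨0, by funext v; simp [lap]⟩, ?_⟩
    simp only [Pi.sub_apply] at hw
    change 1 ≤ D w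
    omega
  · refine ⟨_, fun v => ?_, ⟨indic (Subtype.val ⁻¹' A), rfl⟩, ?_⟩
    · have hv0 := hS v
      simp only [Pi.sub_apply]
      by_cases hvA : (v : V) ∈ A
      · have h1 := effective_sub_lap_argmax G hS hD' v
        have h2 := lap_coe_indic_le H v hvA
        simp only [Pi.sub_apply] at h1
        change 0 ≤ D v - lap G (indic A) v at h1
        omega
      · have := lap_indic_nonpos_of_notMem H.coe (A := Subtype.val ⁻¹' A) (v := v) hvA
        omega
    · have hne : (w : V) ≠ u := fun h => hwA (h ▸ hTu)
      have hadj : H.coe.Adj w ⟨u, huH⟩ := (hu w w.2 hne).symm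
      have h1 := lap_indic_le_neg_one_of_adj H.coe (A := Subtype.val ⁻¹' A)
        (u := ⟨u, huH⟩) hTu hwA hadj
      have h0 := hS w
      simp only [Pi.sub_apply]
      omega
end
end

section
/- Let G be a finite simple graph and let D be an effective divisor of G. If v ∈ V(G) and H is the subgraph of G induced by {v} ∪ {w ∈ V(G) : D(w) = 0}, then the vertex set of the connected component of H that contains v is a subset of clump(G, D, v). -/
open SimpleGraph Finset
open scoped Classical

noncomputable section

/-- A zero of `D` adjacent to a vertex of a clump lies in that clump. -/
theorem mem_clump_of_adj {V : Type} [Finite V] {G : SimpleGraph V} {D : V → ℤ}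
    {v a b : V} (ha : a ∈ clump G D v) (hab : G.Adj a b) (hb : D b = 0) :
    b ∈ clump G D v := by
  rintro S ⟨hv, hS⟩
  by_contra hbS
  have hpos : 0 < (G.neighborSet b ∩ S).ncard :=
    (Set.ncard_pos (Set.toFinite _)).2 ⟨a, hab.symm, ha S ⟨hv, hS⟩⟩
  have hle := hS b hbS
  omega

/-- Let `D` be an effective divisor of `G`, let `v ∈ V(G)` and let `H` be the
subgraph of `G` induced by `{v} ∪ {w : D w = 0}`.  Then every vertex of the
connected component of `H` containing `v` lies in `clump(G, D, v)`. -/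
theorem stmt_7 {V : Type} [Fintype V] (G : SimpleGraph V) (D : V → ℤ)
    (hD : Effective D) (v : V) :
    ∀ u : ↥({v} ∪ {w : V | D w = 0} : Set V),
      (G.induce ({v} ∪ {w : V | D w = 0} : Set V)).Reachable
        ⟨v, Or.inl rfl⟩ u →
      (u : V) ∈ clump G D v := by
  have mem_self : v ∈ clump G D v := fun S hS => hS.1
  intro u hu
  rw [SimpleGraph.reachable_iff_reflTransGen] at hu
  induction hu with
  | refl => exact mem_self
  | @tail b c _ hbc ih =>
    rcases c.2 with hc | hc
    · rw [Set.mem_singleton_iff.1 hc]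
      exact mem_self
    · exact mem_clump_of_adj ih hbc hc
end
end

section
/- Let B be a block of a connected finite simple graph G, and let w_0 and w be vertices in V(B), not necessarily distinct. If D is a w_0-reduced effective divisor of G, then max{D'(w) : D' an effective divisor of G equivalent to D} = max{E(w) : E an effective divisor of B equivalent (in B) to the restriction D|_B}. -/
open SimpleGraph Finset
open scoped Classical

noncomputable section

/-- An effective divisor `D` is `v`-reduced if there is no non-empty `A ⊆ V(G)`
with `v ∉ A` such that `D - Q·1_A` is effective. -/
def VReduced {V : Type} [Fintype V] (G : SimpleGraph V) (v : V) (D : V → ℤ) : Prop :=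
  Effective D ∧ ¬ ∃ A : Set V, A.Nonempty ∧ v ∉ A ∧ Effective (D - lap G (indic A))

/-- A subgraph `B` of `G` is a block if no 2-connected subgraph of `G` properly
contains it, and `B` is 2-connected or isomorphic to `K₂`. -/
def IsBlock {V : Type} [Fintype V] (G : SimpleGraph V) (B : G.Subgraph) : Prop :=
  (¬ ∃ B' : G.Subgraph, KConnected B'.coe 2 ∧ B < B') ∧
  (KConnected B.coe 2 ∨ ∃ u v : V, u ≠ v ∧ B.verts = {u, v} ∧ B.Adj u v)

/-! ### Firing and total degree -/

lemma sum_lap_eq_zero {V : Type} [Fintype V] (G : SimpleGraph V) (S : V → ℤ) :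
    ∑ v, lap G S v = 0 := by
  have h : ∑ v, lap G S v = -∑ v, lap G S v := by
    unfold lap
    conv_lhs => rw [Finset.sum_comm]
    rw [← Finset.sum_neg_distrib]
    refine Finset.sum_congr rfl fun v _ => ?_
    rw [← Finset.sum_neg_distrib]
    refine Finset.sum_congr rfl fun w _ => ?_
    rw [G.adj_comm w v]
    split_ifs <;> lia
  lia

lemma Effective.le_degDiv {V : Type} [Fintype V] {D : V → ℤ} (hD : Effective D) (v : V) :
    D v ≤ degDiv D :=
  Finset.single_le_sum (fun x _ => hD x) (Finset.mem_univ v)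

lemma LinEquiv.degDiv_eq {V : Type} [Fintype V] {G : SimpleGraph V} {D D' : V → ℤ}
    (h : LinEquiv G D D') : degDiv D' = degDiv D := by
  obtain ⟨S, rfl⟩ := h
  simp [degDiv, sum_lap_eq_zero]

/-! ### Paths with both ends in a block -/

lemma SimpleGraph.Walk.reachable_of_forall_adj {V : Type} {H T : SimpleGraph V} {a b : V}
    (p : H.Walk a b)
    (hT : ∀ x ∈ p.support, ∀ y ∈ p.support, H.Adj x y → T.Adj x y) : T.Reachable a b := by
  induction p with
  | nil => exact Reachable.refl _
  | @cons a c b h p ih =>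
    exact (hT a (by simp) c (by simp) h).reachable.trans
      (ih fun x hx y hy => hT x (by simp [hx]) y (by simp [hy]))

/-- A set of at most one vertex cannot separate a vertex of a path from both ends of the path. -/
lemma SimpleGraph.Walk.IsPath.reachable_end_of_avoid {V : Type} {H T : SimpleGraph V}
    {S : Set V} (hS : S.Subsingleton) {a b : V} {p : H.Walk a b} (hp : p.IsPath)
    (hT : ∀ x ∈ p.support, ∀ y ∈ p.support, H.Adj x y → x ∉ S → y ∉ S → T.Adj x y) :
    ∀ x ∈ p.support, x ∉ S →
      (a ∉ S ∧ T.Reachable x a) ∨ (b ∉ S ∧ T.Reachable x b) := by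
  induction p with
  | nil =>
    intro x hx hxS
    obtain rfl : x = _ := by simpa using hx
    exact Or.inl ⟨hxS, Reachable.refl _⟩
  | @cons a c b h p ih =>
    rw [Walk.cons_isPath_iff] at hp
    have hT' : ∀ x ∈ p.support, ∀ y ∈ p.support, H.Adj x y → x ∉ S → y ∉ S → T.Adj x y :=
      fun x hx y hy => hT x (by simp [hx]) y (by simp [hy])
    intro x hx hxS
    rw [Walk.support_cons, List.mem_cons] at hx
    obtain rfl | hx := hx
    · exact Or.inl ⟨hxS, Reachable.refl _⟩
    by_cases ha : a ∈ S
    · have hnot : ∀ y ∈ p.support, y ∉ S := fun y hy hyS => hp.2 (hS ha hyS ▸ hy)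
      have hsub := p.support_dropUntil_subset_support hx
      exact Or.inr ⟨hnot b p.end_mem_support, (p.dropUntil x hx).reachable_of_forall_adj
        fun y hy z hz hyz => hT' y (hsub hy) z (hsub hz) hyz (hnot y (hsub hy))
          (hnot z (hsub hz))⟩
    · obtain ⟨hc, hxc⟩ | hxb := ih hp.1 hT' x hx hxS
      · exact Or.inl ⟨ha, hxc.trans (hT a (by simp) c (by simp) h ha hc).symm.reachable⟩
      · exact Or.inr hxb

/-- Deleting at most one vertex from a block leaves its remaining vertices connected. -/
lemma IsBlock.reachable_of_avoid {V : Type} [Fintype V] {G : SimpleGraph V} {B : G.Subgraph}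
    (hB : IsBlock G B) {S : Set V} (hS : S.Subsingleton) {T : SimpleGraph V}
    (hT : ∀ x y, B.Adj x y → x ∉ S → y ∉ S → T.Adj x y) {x y : V}
    (hx : x ∈ B.verts) (hy : y ∈ B.verts) (hxS : x ∉ S) (hyS : y ∉ S) : T.Reachable x y := by
  obtain ⟨-, hconn⟩ | ⟨u, v, -, hverts, huv⟩ := hB.2
  · let S' : Finset B.verts := Finset.univ.filter fun z => (z : V) ∈ S
    have hS' : S'.card < 2 := by
      refine Nat.lt_succ_of_le (Finset.card_le_one.2 fun a ha b hb => Subtype.ext ?_)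
      simp only [S', Finset.mem_filter, Finset.mem_univ, true_and] at ha hb
      exact hS ha hb
    have hmem (z : ((↑S' : Set B.verts)ᶜ : Set B.verts)) : z.1.1 ∉ S := by
      have := z.2
      simpa [S'] using this
    let f : B.coe.induce (↑S' : Set B.verts)ᶜ →g T :=
      ⟨fun z => z.1.1, fun {a b} hab => hT _ _ hab (hmem a) (hmem b)⟩
    exact ((hconn S' hS').preconnected ⟨⟨x, hx⟩, by simpa [S'] using hxS⟩
      ⟨⟨y, hy⟩, by simpa [S'] using hyS⟩).map f
  · rw [hverts] at hx hy
    obtain rfl | rfl := hx <;> obtain rfl | rfl := hy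
    · exact Reachable.refl _
    · exact (hT _ _ huv hxS hyS).reachable
    · exact (hT _ _ huv.symm hxS hyS).reachable
    · exact Reachable.refl _

lemma kConnected_two_coe_induce {V : Type} [Fintype V] {G : SimpleGraph V} {U : Set V}
    (hcard : 2 < U.ncard)
    (hconn : ∀ S : Set V, S.Subsingleton → ∀ T : SimpleGraph V,
      (∀ x y, T.Adj x y ↔ G.Adj x y ∧ (x ∈ U ∧ x ∉ S) ∧ (y ∈ U ∧ y ∉ S)) →
      ∀ x ∈ U, ∀ y ∈ U, x ∉ S → y ∉ S → T.Reachable x y) :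
    KConnected ((⊤ : G.Subgraph).induce U).coe 2 := by
  have hcard' : Fintype.card ((⊤ : G.Subgraph).induce U).verts = U.ncard := by
    rw [← Nat.card_eq_fintype_card]
    rfl
  refine ⟨hcard' ▸ hcard, fun S hS => ?_⟩
  let S' := (fun z : ((⊤ : G.Subgraph).induce U).verts => z.1) '' (S : Set _)
  have hS' : S'.Subsingleton := Set.Subsingleton.image
    (fun a ha b hb => Finset.card_le_one.1 (Nat.le_of_lt_succ hS) a ha b hb) _
  have hmem (x : V) (hx : x ∈ U) : x ∉ S' ↔
      (⟨x, hx⟩ : ((⊤ : G.Subgraph).induce U).verts) ∈ (↑S : Set _)ᶜ := by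
    simp [S', hx]
  let T : SimpleGraph V :=
    { Adj := fun x y => G.Adj x y ∧ (x ∈ U ∧ x ∉ S') ∧ (y ∈ U ∧ y ∉ S')
      symm := ⟨fun x y h => ⟨h.1.symm, h.2.2, h.2.1⟩⟩
      loopless := ⟨fun x h => h.1.ne rfl⟩ }
  have key : ∀ (x y : V) (_ : T.Walk x y) (hx : x ∈ U) (hy : y ∈ U) (hxS : x ∉ S') (hyS : y ∉ S'),
      (((⊤ : G.Subgraph).induce U).coe.induce (↑S : Set _)ᶜ).Reachable
        ⟨⟨x, hx⟩, (hmem x hx).1 hxS⟩ ⟨⟨y, hy⟩, (hmem y hy).1 hyS⟩ := by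
    intro x y p
    induction p with
    | nil => exact fun _ _ _ _ => Reachable.refl _
    | cons h p ih =>
      intro hx hy hxS hyS
      refine Reachable.trans (Adj.reachable ?_) (ih h.2.2.1 hy h.2.2.2 hyS)
      exact ⟨hx, h.2.2.1, h.1⟩
  have hne : Nonempty ((↑S : Set ((⊤ : G.Subgraph).induce U).verts)ᶜ : Set _) := by
    rw [Set.nonempty_coe_sort, Set.nonempty_iff_ne_empty]
    intro h
    rw [Set.compl_empty_iff, Finset.coe_eq_univ] at h
    rw [h, Finset.card_univ, hcard'] at hS
    lia
  refine ⟨?_⟩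
  rintro ⟨⟨x, hx⟩, hxS⟩ ⟨⟨y, hy⟩, hyS⟩
  obtain ⟨p⟩ := hconn S' hS' T (fun _ _ => Iff.rfl) x hx y hy ((hmem x hx).2 hxS)
    ((hmem y hy).2 hyS)
  exact key x y p hx hy ((hmem x hx).2 hxS) ((hmem y hy).2 hyS)

/-- Two distinct vertices of a block are not joined by a path avoiding the edges of the block. -/
lemma IsBlock.eq_of_reachable {V : Type} [Fintype V] {G : SimpleGraph V} {B : G.Subgraph}
    (hB : IsBlock G B) {a b : V} (ha : a ∈ B.verts) (hb : b ∈ B.verts)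
    (hab : (G \ B.spanningCoe).Reachable a b) : a = b := by
  by_contra hne
  obtain ⟨p, hp⟩ := hab.exists_isPath
  let U : Set V := B.verts ∪ {x | x ∈ p.support}
  obtain ⟨c, hcp, hac⟩ : ∃ c ∈ p.support, (G \ B.spanningCoe).Adj a c := by
    cases p with
    | nil => exact absurd rfl hne
    | cons h p => exact ⟨_, by simp, h⟩
  rw [sdiff_adj, Subgraph.spanningCoe_adj] at hac
  refine hB.1 ⟨(⊤ : G.Subgraph).induce U, kConnected_two_coe_induce ?_ ?_, ?_⟩
  · obtain ⟨hcard, -⟩ | ⟨u, v, huv, hverts, hadj⟩ := hB.2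
    · rw [← Nat.card_eq_fintype_card, Nat.card_coe_set_eq] at hcard
      exact hcard.trans_le (Set.ncard_le_ncard Set.subset_union_left)
    · have hcB : c ∉ B.verts := by
        have := hac.1.ne
        have := hadj.symm
        rw [hverts] at ha hb ⊢
        grind
      rw [Set.two_lt_ncard]
      exact ⟨a, Or.inl ha, b, Or.inl hb, c, Or.inr hcp, hne, fun h => hcB (h ▸ ha),
        fun h => hcB (h ▸ hb)⟩
  · intro S hS T hT
    have hBreach : ∀ x ∈ B.verts, ∀ y ∈ B.verts, x ∉ S → y ∉ S → T.Reachable x y :=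
      fun x hx y hy => hB.reachable_of_avoid hS
        (fun x y h hxS hyS => (hT x y).2
          ⟨h.adj_sub, ⟨Or.inl h.fst_mem, hxS⟩, ⟨Or.inl h.snd_mem, hyS⟩⟩) hx hy
    have hend : ∀ x ∈ U, x ∉ S → ∃ z ∈ B.verts, z ∉ S ∧ T.Reachable x z := by
      rintro x (hx | hx) hxS
      · exact ⟨x, hx, hxS, Reachable.refl _⟩
      · obtain h | h := hp.reachable_end_of_avoid (T := T) hS
          (fun x hx y hy h hxS hyS => (hT x y).2
            ⟨(sdiff_adj _ _ _ _ |>.1 h).1, ⟨Or.inr hx, hxS⟩, ⟨Or.inr hy, hyS⟩⟩) x hx hxS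
        · exact ⟨a, ha, h⟩
        · exact ⟨b, hb, h⟩
    intro x hx y hy hxS hyS
    obtain ⟨x', hx', hxS', hxx'⟩ := hend x hx hxS
    obtain ⟨y', hy', hyS', hyy'⟩ := hend y hy hyS
    exact hxx'.trans ((hBreach x' hx' y' hy' hxS' hyS').trans hyy'.symm)
  · have hle : B ≤ (⊤ : G.Subgraph).induce U :=
      ⟨Set.subset_union_left, fun x y h => ⟨Or.inl h.fst_mem, Or.inl h.snd_mem, h.adj_sub⟩⟩
    refine lt_of_le_of_ne hle fun h => hac.2 ?_
    rw [h]
    exact ⟨Or.inl ha, Or.inr hcp, hac.1⟩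

/-- A block is a retract of the graph along the pieces attached to its vertices. -/
lemma IsBlock.exists_retraction {V : Type} [Fintype V] {G : SimpleGraph V} {B : G.Subgraph}
    (hB : IsBlock G B) (w₀ : B.verts) :
    ∃ π : V → B.verts, (∀ b : B.verts, π b = b) ∧
      ∀ x y, G.Adj x y → ¬ B.Adj x y → π x = π y := by
  let H := G \ B.spanningCoe
  let ρ : H.ConnectedComponent → B.verts := fun C =>
    if h : ∃ b : B.verts, H.connectedComponentMk b = C then h.choose else w₀
  refine ⟨fun x => ρ (H.connectedComponentMk x), fun b => ?_, fun x y hxy hB' => ?_⟩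
  · have h : ∃ b' : B.verts, H.connectedComponentMk b' = H.connectedComponentMk b := ⟨b, rfl⟩
    simp only [ρ, dif_pos h]
    exact Subtype.ext (hB.eq_of_reachable h.choose.2 b.2 (ConnectedComponent.exact h.choose_spec))
  · exact congrArg ρ (ConnectedComponent.sound (Adj.reachable ⟨hxy, hB'⟩))

/-! ### Comparing firings in the graph and in the block -/

section Retraction

variable {V : Type} [Fintype V] {G : SimpleGraph V} {B : G.Subgraph} {π : V → B.verts}

lemma lap_coe_eq (S : V → ℤ) (b : B.verts) :
    lap B.coe (fun y => S y) b = ∑ y : V, if B.Adj b y then S b - S y else 0 := by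
  have h := Finset.sum_subtype (Finset.univ.filter (· ∈ B.verts)) (p := (· ∈ B.verts))
    (F := (inferInstance : Fintype B.verts)) (by simp) (fun y => if B.Adj b y then S b - S y else 0)
  rw [Finset.sum_filter_of_ne] at h
  · rw [h]
    rfl
  · intro y _ hy
    by_contra hyB
    exact hy (if_neg fun h => hyB h.snd_mem)

lemma lap_comp_retraction_of_mem (hπ : ∀ b : B.verts, π b = b)
    (hadj : ∀ x y, G.Adj x y → ¬ B.Adj x y → π x = π y) (S : B.verts → ℤ) (b : B.verts) :
    lap G (S ∘ π) b = lap B.coe S b := by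
  have h := lap_coe_eq (S ∘ π) b
  simp only [Function.comp_apply, hπ] at h
  rw [h]
  refine Finset.sum_congr rfl fun y _ => ?_
  by_cases hG : G.Adj b y
  · by_cases hby : B.Adj b y
    · simp [hG, hby, hπ]
    · simp [hby, ← hadj _ _ hG hby, hπ]
  · rw [if_neg hG, if_neg fun h => hG h.adj_sub]

lemma lap_comp_retraction_of_notMem
    (hadj : ∀ x y, G.Adj x y → ¬ B.Adj x y → π x = π y) (S : B.verts → ℤ) {x : V}
    (hx : x ∉ B.verts) : lap G (S ∘ π) x = 0 := by
  refine Finset.sum_eq_zero fun y _ => ?_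
  split_ifs with h
  · simp [hadj x y h fun h' => hx h'.fst_mem]
  · rfl

/-- An effective divisor obtained from a reduced one by firing `S` has, on each piece attached to
the block, the maximum of `S` at the attaching vertex. -/
lemma VReduced.le_retraction {w₀ : V} {D : V → ℤ} (hred : VReduced G w₀ D)
    (hw₀ : w₀ ∈ B.verts) (hπ : ∀ b : B.verts, π b = b)
    (hadj : ∀ x y, G.Adj x y → ¬ B.Adj x y → π x = π y) {S : V → ℤ}
    (hS : Effective (D - lap G S)) (x : V) : S x ≤ S (π x) := by
  by_contra! hx
  obtain ⟨m, hm, hmax⟩ := (Finset.univ.filter fun y => π y = π x).exists_max_image S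
    ⟨x, by simp⟩
  simp only [Finset.mem_filter, Finset.mem_univ, true_and] at hm hmax
  let A : Set V := {y | π y = π x ∧ S y = S m}
  have hAB : ∀ y ∈ A, y ∉ B.verts := by
    rintro y ⟨hyx, hym⟩ hyB
    have h1 : y = π x := by rw [← hyx, hπ ⟨y, hyB⟩]
    have h2 := hmax x rfl
    rw [h1] at hym
    lia
  refine hred.2 ⟨A, ⟨m, hm, rfl⟩, fun h => hAB _ h hw₀, fun y => ?_⟩
  by_cases hy : y ∈ A
  · refine (hS y).trans (sub_le_sub_left (Finset.sum_le_sum fun z _ => ?_) _)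
    split_ifs with hyz
    · have hz : π z = π x := (hadj y z hyz fun h => hAB y hy h.fst_mem) ▸ hy.1
      have hzm := hmax z hz
      have hym := hy.2
      by_cases hzA : z ∈ A
      · simp [indic, hy, hzA, hym, hzA.2]
      · have : S z ≠ S m := fun h => hzA ⟨hz, h⟩
        simp only [indic, if_pos hy, if_neg hzA]
        lia
    · rfl
  · have h1 : lap G (indic A) y ≤ 0 := Finset.sum_nonpos fun z _ => by
      simp only [indic, if_neg hy]
      split_ifs <;> lia
    have h2 := hred.1 y
    simp only [Pi.sub_apply]
    lia

lemma lap_coe_le_lap (hπ : ∀ b : B.verts, π b = b)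
    (hadj : ∀ x y, G.Adj x y → ¬ B.Adj x y → π x = π y) {S : V → ℤ}
    (hS : ∀ x, S x ≤ S (π x)) (b : B.verts) :
    lap B.coe (fun y => S y) b ≤ lap G S b := by
  rw [lap_coe_eq]
  refine Finset.sum_le_sum fun y _ => ?_
  by_cases hby : B.Adj b y
  · simp [hby, hby.adj_sub]
  · rw [if_neg hby]
    split_ifs with hG
    · have := hS y
      rw [← hadj _ _ hG hby, hπ] at this
      lia
    · rfl

end Retraction

/-- Let `B` be a block of a connected graph `G`, let `w₀, w ∈ V(B)` and let `D` be a
`w₀`-reduced effective divisor of `G`.  Then the maximum of `D' w` over effective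
divisors `D'` of `G` equivalent to `D` equals the maximum of `E w` over effective
divisors `E` of `B` equivalent to the restriction `D|_B`. -/
theorem stmt_10 {V : Type} [Fintype V] (G : SimpleGraph V) (hG : G.Connected)
    (B : G.Subgraph) (hB : IsBlock G B)
    (w₀ w : V) (hw₀ : w₀ ∈ B.verts) (hw : w ∈ B.verts)
    (D : V → ℤ) (hred : VReduced G w₀ D) :
    sSup {z : ℤ | ∃ D' : V → ℤ, Effective D' ∧ LinEquiv G D D' ∧ D' w = z} =
    sSup {z : ℤ | ∃ E : ↥B.verts → ℤ, Effective E ∧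
      LinEquiv B.coe (fun y : ↥B.verts => D y.val) E ∧ E ⟨w, hw⟩ = z} := by
  obtain ⟨π, hπ, hadj⟩ := hB.exists_retraction ⟨w₀, hw₀⟩
  have hsub : {z : ℤ | ∃ E : ↥B.verts → ℤ, Effective E ∧
      LinEquiv B.coe (fun y : ↥B.verts => D y.val) E ∧ E ⟨w, hw⟩ = z} ⊆
      {z : ℤ | ∃ D' : V → ℤ, Effective D' ∧ LinEquiv G D D' ∧ D' w = z} := by
    rintro z ⟨_, hE, ⟨S, rfl⟩, rfl⟩
    have hlap (b : B.verts) := lap_comp_retraction_of_mem hπ hadj S b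
    refine ⟨D - lap G (S ∘ π), fun x => ?_, ⟨_, rfl⟩, ?_⟩
    · by_cases hx : x ∈ B.verts
      · have h := hE ⟨x, hx⟩
        rwa [Pi.sub_apply, ← hlap] at h
      · rw [Pi.sub_apply, lap_comp_retraction_of_notMem hadj S hx, sub_zero]
        exact hred.1 x
    · rw [Pi.sub_apply, Pi.sub_apply, ← hlap]
  have hbdd : BddAbove {z : ℤ | ∃ D' : V → ℤ, Effective D' ∧ LinEquiv G D D' ∧ D' w = z} := by
    refine ⟨degDiv D, ?_⟩
    rintro z ⟨D', hD', hDD', rfl⟩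
    exact hDD'.degDiv_eq ▸ hD'.le_degDiv w
  refine le_antisymm (csSup_le ⟨D w, D, hred.1, ⟨0, ?_⟩, rfl⟩ ?_)
    (csSup_le_csSup hbdd ⟨D w, fun y => D y.val, fun y => hred.1 y, ⟨0, ?_⟩, rfl⟩ hsub)
  · ext v
    simp [lap]
  · rintro z ⟨_, hD', ⟨S, rfl⟩, rfl⟩
    have hle := lap_coe_le_lap hπ hadj (hred.le_retraction hw₀ hπ hadj hD')
    refine le_csSup_of_le (hbdd.mono hsub)
      ⟨_, fun b => (hD' b).trans (sub_le_sub_left (hle b) _), ⟨fun y => S y, rfl⟩, rfl⟩ ?_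
    exact sub_le_sub_left (hle ⟨w, hw⟩) _
  · ext v
    simp [lap]
end
end

section
/- If G is a connected finite simple graph, v ∈ V(G), and D is a v-reduced effective divisor of G, then D(v) = max{D'(v) : D' an effective divisor of G equivalent to D}. -/
open SimpleGraph Finset
open scoped Classical

noncomputable section

/-- If `G` is connected, `v ∈ V(G)` and `D` is a `v`-reduced effective divisor of
`G`, then `D v` is the maximum of `D' v` over effective divisors `D'` equivalent
to `D`. -/
theorem stmt_11 {V : Type} [Fintype V] (G : SimpleGraph V) (hG : G.Connected)
    (v : V) (D : V → ℤ) (hred : VReduced G v D) :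
    IsGreatest {z : ℤ | ∃ D' : V → ℤ, Effective D' ∧ LinEquiv G D D' ∧ D' v = z}
      (D v) := by
  obtain ⟨hD, hfire⟩ := hred
  refine ⟨⟨D, hD, ⟨0, by ext u; simp [lap]⟩, rfl⟩, ?_⟩
  rintro _ ⟨D', hD', ⟨S, rfl⟩, rfl⟩
  obtain ⟨m, -, hm⟩ := Finset.exists_max_image univ S ⟨v, mem_univ v⟩
  have hmax : ∀ u, S u ≤ S m := fun u => hm u (mem_univ u)
  by_cases hv : S v = S m
  · have h : 0 ≤ lap G S v := by
      refine Finset.sum_nonneg fun w _ => ?_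
      have := hmax w
      split_ifs <;> omega
    simpa using h
  · refine (hfire ⟨{u | S u = S m}, ⟨m, rfl⟩, hv, fun u => ?_⟩).elim
    by_cases hu : S u = S m
    · have h : lap G (indic {u | S u = S m}) u ≤ lap G S u := by
        refine Finset.sum_le_sum fun w _ => ?_
        have := hmax w
        simp only [indic, Set.mem_ofPred_eq]
        split_ifs <;> omega
      have := hD' u
      simp only [Pi.sub_apply] at this ⊢
      linarith
    · have h : lap G (indic {u | S u = S m}) u ≤ 0 := by
        refine Finset.sum_nonpos fun w _ => ?_
        simp only [indic, Set.mem_ofPred_eq]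
        split_ifs <;> omega
      have := hD u
      simp only [Pi.sub_apply]
      linarith
end
end
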